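/- Let G be a connected finite simple graph of order n, minimum degree δ ≥ 3, maximum degree at least Δ, and girth at least 6. Then avec(G) ≤ ((n − Δ*)/(2δ*))·((9n + 3Δ*)/n) + 21, where δ* = 2(δ² − δ + 1) and Δ* = Δδ + (δ−1)·√(Δ(δ−2)) + 3/2. -/

import Mathlib

open SimpleGraph

/-- The eccentricity of a vertex `v`: the maximum distance from `v` to a vertex of `G`. -/
noncomputable def eccent {V : Type*} (G : SimpleGraph V) (v : V) : ℕ :=
  sSup (Set.range (G.dist v))

/-- The average eccentricity of a finite graph `G`. -/
noncomputable def avec {V : Type*} (G : SimpleGraph V) : ℝ :=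
  (∑ᶠ v, (eccent G v : ℝ)) / (Nat.card V)

/-- `G` contains no cycle of length `m` as a (not necessarily induced) subgraph. -/
def CycleFree {V : Type*} (G : SimpleGraph V) (m : ℕ) : Prop :=
  ∀ ⦃v : V⦄ (w : G.Walk v v), w.IsCycle → w.length ≠ m

/-! ### Metrics of finite trees -/

/-- The properties of the distance function of a tree used below: it satisfies the four point
condition and any two points are joined by a geodesic. -/
structure IsTreeMetric {I : Type} (D : I → I → ℕ) : Prop where
  self : ∀ i, D i i = 0
  symm : ∀ i j, D i j = D j i
  four_point : ∀ i j k l, D i j + D k l ≤ max (D i k + D j l) (D i l + D j k)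
  exists_between : ∀ i j s t, D i j = s + t → ∃ p, D i p = s ∧ D p j = t

/-- The distance function obtained from `D` by attaching a new leaf at `p`. -/
def attachLeaf {I : Type} (D : I → I → ℕ) (p : I) : Option I → Option I → ℕ
  | none, none => 0
  | none, some j => D p j + 1
  | some i, none => D i p + 1
  | some i, some j => D i j

namespace IsTreeMetric

variable {I : Type} {D : I → I → ℕ}

theorem triangle (h : IsTreeMetric D) (i j k : I) : D i j ≤ D i k + D k j := by
  have h₁ := h.four_point i j k k
  have h₂ := h.self k
  have h₃ := h.symm j k
  omega

theorem attachLeaf (h : IsTreeMetric D) (p : I) : IsTreeMetric (attachLeaf D p) where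
  self i := by cases i <;> simp [_root_.attachLeaf, h.self]
  symm i j := by cases i <;> cases j <;> simp [_root_.attachLeaf, h.symm]
  four_point i j k l := by
    have hs := h.symm
    have ht := h.triangle
    have h₄ := h.four_point
    have h₄' := h₄ (i.getD p) (j.getD p) (k.getD p) (l.getD p)
    rcases i with _ | i <;> rcases j with _ | j <;> rcases k with _ | k <;> rcases l with _ | l <;>
      simp only [_root_.attachLeaf, Option.getD] at h₄' ⊢ <;> grind [h.self p]
  exists_between i j s t hst := by
    rcases i with _ | i <;> rcases j with _ | j <;> simp only [_root_.attachLeaf] at hst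
    · exact ⟨none, by simp only [_root_.attachLeaf]; omega, by simp only [_root_.attachLeaf]; omega⟩
    · rcases s with _ | s
      · exact ⟨none, rfl, by simp only [_root_.attachLeaf]; omega⟩
      · obtain ⟨q, hq₁, hq₂⟩ := h.exists_between p j s t (by omega)
        exact ⟨some q, by simp [_root_.attachLeaf, hq₁], by simp [_root_.attachLeaf, hq₂]⟩
    · rcases t with _ | t
      · exact ⟨none, by simp only [_root_.attachLeaf]; omega, rfl⟩
      · obtain ⟨q, hq₁, hq₂⟩ := h.exists_between i p s t (by omega)
        exact ⟨some q, by simp [_root_.attachLeaf, hq₁], by simp [_root_.attachLeaf, hq₂]⟩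
    · obtain ⟨q, hq₁, hq₂⟩ := h.exists_between i j s t hst
      exact ⟨some q, by simp [_root_.attachLeaf, hq₁], by simp [_root_.attachLeaf, hq₂]⟩

end IsTreeMetric

theorem sq_le_four_mul_sum_min (d : ℕ) :
    d ^ 2 ≤ 4 * ∑ t ∈ Finset.range (d + 1), min t (d - t) + 1 := by
  induction d using Nat.twoStepInduction with
  | zero => simp
  | one => simp
  | more d ih _ =>
    have hstep : ∑ t ∈ Finset.range (d + 1), min (t + 1) (d + 2 - (t + 1))
        = ∑ t ∈ Finset.range (d + 1), min t (d - t) + (d + 1) := by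
      have hone : ∑ t ∈ Finset.range (d + 1), 1 = d + 1 := by simp
      rw [← Nat.add_right_inj.2 hone, ← Finset.sum_add_distrib]
      refine Finset.sum_congr rfl fun t ht => ?_
      have := Finset.mem_range.1 ht
      omega
    rw [Finset.sum_range_succ, Finset.sum_range_succ', hstep]
    simp
    nlinarith

/-- In a weighted tree with all weights at least `c`, the total weighted eccentricity is at most
`(∑ w) d - c (d² - 1) / 4`, where `d` is the diameter. -/
theorem IsTreeMetric.sum_weight_mul_ecc_le {I : Type} [Fintype I] [Nonempty I] {D : I → I → ℕ}
    (h : IsTreeMetric D) (w : I → ℝ) (c : ℝ) (hc : 0 ≤ c) (hw : ∀ i, c ≤ w i) :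
    ∃ d : ℕ, d + 1 ≤ Fintype.card I ∧
      ∑ i, w i * (Finset.univ.sup (D i) : ℕ) ≤ (∑ i, w i) * d - c * ((d : ℝ) ^ 2 - 1) / 4 := by
  classical
  obtain ⟨⟨x, y⟩, hxy⟩ := Finite.exists_max fun q : I × I => D q.1 q.2
  replace hxy : ∀ i j, D i j ≤ D x y := fun i j => hxy (i, j)
  obtain ⟨d, hd⟩ : ∃ d, D x y = d := ⟨_, rfl⟩
  rw [hd] at hxy
  have hp : ∀ t : ℕ, ∃ p, t ≤ d → D x p = t ∧ D p y = d - t := fun t => by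
    by_cases ht : t ≤ d
    · obtain ⟨p, hp⟩ := h.exists_between x y t (d - t) (by omega)
      exact ⟨p, fun _ => hp⟩
    · exact ⟨x, fun h => absurd h ht⟩
  choose p hp using hp
  have hinj : Set.InjOn p (Finset.range (d + 1)) := by
    intro s hs t ht hst
    simp only [Finset.coe_range, Set.mem_Iio] at hs ht
    rw [← (hp s (by omega)).1, ← (hp t (by omega)).1, hst]
  have hle : ∀ i, Finset.univ.sup (D i) ≤ d := fun i => Finset.sup_le fun j _ => hxy i j
  have hpath : ∀ t ∈ Finset.range (d + 1), min t (d - t) ≤ d - Finset.univ.sup (D (p t)) := by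
    intro t ht
    obtain ⟨h₁, h₂⟩ := hp t (by have := Finset.mem_range.1 ht; omega)
    have : Finset.univ.sup (D (p t)) ≤ max t (d - t) := Finset.sup_le fun z _ => by
      have h₃ := h.four_point x y (p t) z
      have h₄ := hxy y z
      have h₅ := hxy x z
      have h₆ := h.symm (p t) y
      omega
    have := Finset.mem_range.1 ht
    omega
  refine ⟨d, ?_, ?_⟩
  · calc d + 1 = ((Finset.range (d + 1)).image p).card := by
          rw [Finset.card_image_of_injOn hinj, Finset.card_range]
      _ ≤ _ := Finset.card_le_univ _
  have hdef : c * ((d : ℝ) ^ 2 - 1) / 4 ≤ ∑ i, w i * (d - (Finset.univ.sup (D i) : ℕ)) := by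
    have hq : ((d : ℝ) ^ 2 - 1) / 4 ≤ ∑ t ∈ Finset.range (d + 1), ((min t (d - t) : ℕ) : ℝ) := by
      have := sq_le_four_mul_sum_min d
      rify at this ⊢
      linarith
    have hnn : ∀ i, (0 : ℝ) ≤ d - (Finset.univ.sup (D i) : ℕ) := fun i =>
      sub_nonneg.2 (Nat.cast_le.2 (hle i))
    calc c * ((d : ℝ) ^ 2 - 1) / 4 = c * (((d : ℝ) ^ 2 - 1) / 4) := by ring
      _ ≤ c * ∑ t ∈ Finset.range (d + 1), ((min t (d - t) : ℕ) : ℝ) := by gcongr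
      _ = ∑ t ∈ Finset.range (d + 1), c * ((min t (d - t) : ℕ) : ℝ) := Finset.mul_sum _ _ _
      _ ≤ ∑ t ∈ Finset.range (d + 1), w (p t) * (d - (Finset.univ.sup (D (p t)) : ℕ)) := by
          refine Finset.sum_le_sum fun t ht => mul_le_mul (hw _) ?_ (by positivity)
            (hc.trans (hw _))
          rw [← Nat.cast_sub (hle _)]
          exact Nat.cast_le.2 (hpath t ht)
      _ = ∑ i ∈ (Finset.range (d + 1)).image p, w i * (d - (Finset.univ.sup (D i) : ℕ)) :=
          (Finset.sum_image (f := fun i => w i * (d - (Finset.univ.sup (D i) : ℕ))) hinj).symm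
      _ ≤ _ := Finset.sum_le_sum_of_subset_of_nonneg (Finset.subset_univ _)
          fun i _ _ => mul_nonneg (hc.trans (hw i)) (hnn i)
  simp only [mul_sub, Finset.sum_sub_distrib, ← Finset.sum_mul] at hdef
  linarith

/-! ### Clusterings -/

/-- A family of vertex sets, pairwise at distance at least five, each containing an edge and one
of them being the closed neighbourhood of `r`, together with a tree metric on the index set such
that a step in the tree accounts for a distance of at most six in the graph. -/
structure IsClustering {V : Type*} (G : SimpleGraph V) (r : V) {I : Type} (D : I → I → ℕ)
    (S : I → Set V) (i₀ : I) : Prop where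
  tree : IsTreeMetric D
  root : S i₀ = insert r (G.neighborSet r)
  exists_adj : ∀ i, ∃ a ∈ S i, ∃ b ∈ S i, G.Adj a b
  separated : ∀ i j, i ≠ j → ∀ u ∈ S i, ∀ v ∈ S j, 5 ≤ G.dist u v
  dist_le : ∀ i j, ∀ u ∈ S i, ∀ v ∈ S j, G.dist u v ≤ 6 * D i j + 2

namespace IsClustering

variable {V : Type*} {G : SimpleGraph V} {r : V}

theorem card_le [Fintype V] {I : Type} [Fintype I] {D : I → I → ℕ} {S : I → Set V} {i₀ : I}
    (h : IsClustering G r D S i₀) : Fintype.card I ≤ Fintype.card V := by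
  choose a ha _ using h.exists_adj
  refine Fintype.card_le_of_injective a fun i j hij => ?_
  by_contra hne
  have := h.separated i j hne _ (ha i) _ (ha j)
  simp [hij] at this

theorem of_adj (hG : G.Connected) {s : V} (hs : G.Adj r s) :
    IsClustering G r (fun _ _ : Unit => 0) (fun _ => insert r (G.neighborSet r)) () where
  tree := ⟨by simp, by simp, by simp, fun _ _ s t h => ⟨(), by omega, by omega⟩⟩
  root := rfl
  exists_adj _ := ⟨r, by simp, s, by simp [hs], hs⟩
  separated i j hij := absurd rfl hij
  dist_le _ _ u hu v hv := by
    have key : ∀ x ∈ insert r (G.neighborSet r), G.dist r x ≤ 1 := by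
      rintro x (rfl | hx)
      · simp
      · exact (dist_eq_one_iff_adj.2 hx).le
    have h₁ := key u hu
    have h₂ := key v hv
    have h₃ := hG.dist_triangle (u := u) (v := r) (w := v)
    rw [G.dist_comm (u := u) (v := r)] at h₃
    omega

theorem exists_extension (hG : G.Connected) {I : Type} {D : I → I → ℕ} {S : I → Set V} {i₀ : I}
    (h : IsClustering G r D S i₀) {x : V} (hx : ∀ i, ∀ u ∈ S i, 5 < G.dist u x) :
    ∃ D' : Option I → Option I → ℕ, ∃ S', IsClustering G r D' S' (some i₀) := by
  obtain ⟨z, hz⟩ : ∃ z, z ∈ S i₀ := ⟨r, by simp [h.root]⟩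
  obtain ⟨w⟩ := hG.preconnected z x
  obtain ⟨⟨⟨a, b⟩, hab⟩, -, ⟨i, u, hu, hua⟩, hb⟩ := w.exists_boundary_dart
    {v | ∃ i, ∃ u ∈ S i, G.dist u v ≤ 5} ⟨i₀, z, hz, by simp⟩
    (by rintro ⟨i, u, hu, hux⟩; exact absurd (hx i u hu) (by omega))
  simp only [Set.mem_ofPred_eq, not_exists, not_and, not_le] at hua hb hab
  have hab₁ : G.dist a b = 1 := dist_eq_one_iff_adj.2 hab
  have hcomm := fun u v => G.dist_comm (u := u) (v := v)
  have hfar : ∀ i, ∀ u ∈ S i, ∀ v ∈ ({a, b} : Set V), 5 ≤ G.dist u v := by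
    intro i u hu v hv
    have h₁ := hb i u hu
    have h₂ := hG.dist_triangle (u := u) (v := a) (w := b)
    rcases hv with rfl | rfl <;> omega
  have hnear : ∀ v ∈ ({a, b} : Set V), G.dist a v ≤ 1 := by
    rintro v (rfl | rfl)
    · simp
    · omega
  have hsome : ∀ j, ∀ v ∈ S j, ∀ c ∈ ({a, b} : Set V), G.dist v c ≤ 6 * (D i j + 1) + 2 := by
    intro j v hv c hc
    have h₁ := hG.dist_triangle (u := v) (v := a) (w := c)
    have h₂ := hG.dist_triangle (u := v) (v := u) (w := a)
    have h₃ := hnear c hc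
    have h₄ := h.dist_le i j u hu v hv
    have h₅ := hcomm u v
    omega
  refine ⟨attachLeaf D i, fun o => o.elim {a, b} S, h.tree.attachLeaf i, h.root, ?_, ?_, ?_⟩
  · rintro (_ | j)
    · exact ⟨a, by simp, b, by simp, hab⟩
    · exact h.exists_adj j
  · rintro (_ | j) (_ | k) hjk u hu v hv
    · exact absurd rfl hjk
    · rw [hcomm]; exact hfar k v hv u hu
    · exact hfar j u hu v hv
    · exact h.separated j k (by simpa using hjk) u hu v hv
  · rintro (_ | j) (_ | k) u hu v hv
    · have h₁ := hnear u hu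
      have h₂ := hnear v hv
      have h₃ := hG.dist_triangle (u := u) (v := a) (w := v)
      have h₄ := hcomm u a
      omega
    · rw [hcomm]; exact hsome k v hv u hu
    · simpa only [attachLeaf, h.tree.symm j i] using hsome j u hu v hv
    · exact h.dist_le j k u hu v hv

/-- Some clustering has every vertex of the graph within distance five of one of its members. -/
theorem exists_dominating [Fintype V] (hG : G.Connected) {s : V} (hs : G.Adj r s) :
    ∃ (I : Type) (_ : Fintype I) (D : I → I → ℕ) (S : I → Set V) (i₀ : I),
      IsClustering G r D S i₀ ∧ ∀ x, ∃ i, ∃ u ∈ S i, G.dist u x ≤ 5 := by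
  by_contra! hcon
  have key : ∀ m : ℕ, ∃ (I : Type) (_ : Fintype I) (D : I → I → ℕ) (S : I → Set V) (i₀ : I),
      IsClustering G r D S i₀ ∧ m ≤ Fintype.card I := by
    intro m
    induction m with
    | zero => exact ⟨Unit, inferInstance, _, _, _, of_adj hG hs, by simp⟩
    | succ m ih =>
      obtain ⟨I, _, D, S, i₀, h, hm⟩ := ih
      obtain ⟨x, hx⟩ := hcon I inferInstance D S i₀ h
      obtain ⟨D', S', h'⟩ := h.exists_extension hG hx
      exact ⟨Option I, inferInstance, D', S', _, h', by simpa using hm⟩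
  obtain ⟨I, _, D, S, i₀, h, hm⟩ := key (Fintype.card V + 1)
  have := h.card_le
  omega

end IsClustering

/-! ### Graphs of girth at least six -/

namespace SimpleGraph

variable {V : Type*} {G : SimpleGraph V}

theorem dist_le_two_of_adj_of_adj {a x z : V} (h₁ : G.Adj a x) (h₂ : G.Adj x z) :
    G.dist a z ≤ 2 :=
  dist_le (Walk.cons h₁ (.cons h₂ .nil))

theorem false_of_triangle_of_six_le_egirth (hg : 6 ≤ G.egirth) {a b c : V} (h₁ : G.Adj a b)
    (h₂ : G.Adj b c) (h₃ : G.Adj c a) : False := by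
  have hc : (Walk.cons h₁ (.cons h₂ (.cons h₃ .nil))).IsCycle := by
    simp [Walk.cons_isCycle_iff, Walk.cons_isPath_iff, h₁.ne, h₁.ne', h₂.ne, h₃.ne, h₃.ne']
  have := le_egirth.1 hg a _ hc
  norm_num at this

theorem eq_of_common_neighbors_of_six_le_egirth (hg : 6 ≤ G.egirth) {a b c d : V}
    (h₁ : G.Adj a b) (h₂ : G.Adj b c) (h₃ : G.Adj c d) (h₄ : G.Adj d a) (hac : a ≠ c) :
    b = d := by
  by_contra hbd
  have hc : (Walk.cons h₁ (.cons h₂ (.cons h₃ (.cons h₄ .nil)))).IsCycle := by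
    simp [Walk.cons_isCycle_iff, Walk.cons_isPath_iff, h₁.ne, h₁.ne', h₂.ne, h₃.ne, h₄.ne,
      h₄.ne', hac, hac.symm, hbd]
  have := le_egirth.1 hg a _ hc
  norm_num at this

theorem false_of_closed_five_of_six_le_egirth (hg : 6 ≤ G.egirth) {a b c d e : V}
    (h₁ : G.Adj a b) (h₂ : G.Adj b c) (h₃ : G.Adj c d) (h₄ : G.Adj d e) (h₅ : G.Adj e a) :
    False := by
  have tri := fun {a b c : V} => false_of_triangle_of_six_le_egirth hg (a := a) (b := b) (c := c)
  have hac : a ≠ c := by rintro rfl; exact tri h₃ h₄ h₅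
  have had : a ≠ d := by rintro rfl; exact tri h₁ h₂ h₃
  have hbd : b ≠ d := by rintro rfl; exact tri h₄ h₅ h₁
  have hbe : b ≠ e := by rintro rfl; exact tri h₂ h₃ h₄
  have hce : c ≠ e := by rintro rfl; exact tri h₁ h₂ h₅
  have hc : (Walk.cons h₁ (.cons h₂ (.cons h₃ (.cons h₄ (.cons h₅ .nil))))).IsCycle := by
    simp [Walk.cons_isCycle_iff, Walk.cons_isPath_iff, h₁.ne, h₁.ne', h₂.ne, h₃.ne, h₄.ne,
      h₅.ne, h₅.ne', hac, hac.symm, had, had.symm, hbd, hbe, hce]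
  have := le_egirth.1 hg a _ hc
  norm_num at this

variable [Fintype V] [DecidableEq V] [DecidableRel G.Adj]

variable (G) in
/-- The vertices joined to `a` by a walk of length two. -/
def twoStep (a : V) : Finset V := (G.neighborFinset a).biUnion (fun x => G.neighborFinset x)

theorem mem_twoStep {a z : V} : z ∈ G.twoStep a ↔ ∃ x, G.Adj a x ∧ G.Adj x z := by
  simp [twoStep]

theorem degree_mul_le_card_twoStep_erase (hg : 6 ≤ G.egirth) (a : V) :
    G.degree a * (G.minDegree - 1) ≤ ((G.twoStep a).erase a).card := by
  have hsub : (G.neighborFinset a).biUnion (fun x => (G.neighborFinset x).erase a) ⊆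
      (G.twoStep a).erase a := by
    intro z
    simp only [Finset.mem_biUnion, Finset.mem_erase, mem_neighborFinset, mem_twoStep]
    grind
  refine le_trans ?_ (Finset.card_le_card hsub)
  rw [Finset.card_biUnion, ← card_neighborFinset_eq_degree, ← smul_eq_mul]
  · refine Finset.card_nsmul_le_sum _ _ _ fun x hx => ?_
    rw [Finset.card_erase_of_mem (by simpa [adj_comm] using hx), card_neighborFinset_eq_degree]
    exact Nat.sub_le_sub_right (G.minDegree_le_degree x) 1
  · intro x hx y hy hxy
    rw [Function.onFun, Finset.disjoint_left]
    intro z hz hz'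
    simp only [Finset.mem_erase, mem_neighborFinset, SetLike.mem_coe] at hx hy hz hz'
    exact hxy (eq_of_common_neighbors_of_six_le_egirth hg hx hz.2 hz'.2.symm hy.symm hz.1.symm)

theorem one_add_le_card_twoStep (hg : 6 ≤ G.egirth) (h0 : 0 < G.minDegree) (a : V) :
    1 + G.degree a * (G.minDegree - 1) ≤ (G.twoStep a).card := by
  obtain ⟨x, hx⟩ := (G.degree_pos_iff_exists_adj a).1 (h0.trans_le (G.minDegree_le_degree a))
  have ha : a ∈ G.twoStep a := mem_twoStep.2 ⟨x, hx, hx.symm⟩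
  rw [← Finset.card_erase_add_one ha]
  have := degree_mul_le_card_twoStep_erase hg a
  omega

/-- The ball of radius two around an edge has at least `2 (δ² - δ + 1)` vertices. -/
theorem two_mul_le_card_of_adj (hg : 6 ≤ G.egirth) (h0 : 0 < G.minDegree) {a b : V}
    (hab : G.Adj a b) {B : Finset V} (ha : ∀ x, G.dist a x ≤ 2 → x ∈ B)
    (hb : ∀ x, G.dist b x ≤ 2 → x ∈ B) :
    2 * (1 + G.minDegree * (G.minDegree - 1)) ≤ B.card := by
  have hdisj : Disjoint (G.twoStep a) (G.twoStep b) := by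
    rw [Finset.disjoint_left]
    intro z hz hz'
    obtain ⟨x, hx₁, hx₂⟩ := mem_twoStep.1 hz
    obtain ⟨y, hy₁, hy₂⟩ := mem_twoStep.1 hz'
    exact false_of_closed_five_of_six_le_egirth hg hab hy₁ hy₂ hx₂.symm hx₁.symm
  have hsub : G.twoStep a ∪ G.twoStep b ⊆ B := by
    refine Finset.union_subset (fun z hz => ?_) fun z hz => ?_
    · obtain ⟨x, hx₁, hx₂⟩ := mem_twoStep.1 hz
      exact ha z (dist_le_two_of_adj_of_adj hx₁ hx₂)
    · obtain ⟨x, hx₁, hx₂⟩ := mem_twoStep.1 hz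
      exact hb z (dist_le_two_of_adj_of_adj hx₁ hx₂)
  have h₁ := one_add_le_card_twoStep hg h0 a
  have h₂ := one_add_le_card_twoStep hg h0 b
  have h₃ := Nat.mul_le_mul_right (G.minDegree - 1) (G.minDegree_le_degree a)
  have h₄ := Nat.mul_le_mul_right (G.minDegree - 1) (G.minDegree_le_degree b)
  have h₅ := Finset.card_le_card hsub
  rw [Finset.card_union_of_disjoint hdisj] at h₅
  omega

/-- The ball of radius three around `r` has at least `1 + d δ + m` vertices, where `d` is the
degree of `r` and `m (m - 1) ≥ d (δ - 1)² (δ - 2)`. -/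
theorem exists_le_card_of_ball_three (hg : 6 ≤ G.egirth) (h0 : 0 < G.minDegree) (r : V)
    {B : Finset V} (hB : ∀ u ∈ insert r (G.neighborSet r), ∀ x, G.dist u x ≤ 2 → x ∈ B) :
    ∃ m : ℕ, 1 + G.degree r * G.minDegree + m ≤ B.card ∧
      G.degree r * (G.minDegree - 1) * ((G.minDegree - 1) * (G.minDegree - 2)) ≤ m * (m - 1) := by
  set M := (G.twoStep r).erase r with hM
  set L := M.biUnion (fun x => G.neighborFinset x) \ G.neighborFinset r with hL
  refine ⟨L.card, ?_, ?_⟩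
  · have hd₁ : Disjoint (G.neighborFinset r) L := Finset.disjoint_sdiff
    have hd₂ : Disjoint (G.twoStep r) (G.neighborFinset r ∪ L) := by
      rw [Finset.disjoint_left]
      intro z hz hz'
      obtain ⟨x, hx₁, hx₂⟩ := mem_twoStep.1 hz
      rcases Finset.mem_union.1 hz' with hz' | hz'
      · exact false_of_triangle_of_six_le_egirth hg hx₁ hx₂ ((mem_neighborFinset _ _ _).1 hz').symm
      · simp only [hL, hM, Finset.mem_sdiff, Finset.mem_biUnion, Finset.mem_erase,
          mem_neighborFinset, mem_twoStep] at hz'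
        obtain ⟨⟨y, ⟨-, t, ht₁, ht₂⟩, hyz⟩, -⟩ := hz'
        exact false_of_closed_five_of_six_le_egirth hg hx₁ hx₂ hyz.symm ht₂.symm ht₁.symm
    have hsub : G.twoStep r ∪ (G.neighborFinset r ∪ L) ⊆ B := by
      refine Finset.union_subset (fun z hz => ?_)
        (Finset.union_subset (fun z hz => ?_) fun z hz => ?_)
      · obtain ⟨x, hx₁, hx₂⟩ := mem_twoStep.1 hz
        exact hB r (by simp) z (dist_le_two_of_adj_of_adj hx₁ hx₂)
      · exact hB z (by simp [(mem_neighborFinset _ _ _).1 hz]) z (by simp)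
      · simp only [hL, hM, Finset.mem_sdiff, Finset.mem_biUnion, Finset.mem_erase,
          mem_neighborFinset, mem_twoStep] at hz
        obtain ⟨⟨y, ⟨-, t, ht₁, ht₂⟩, hyz⟩, -⟩ := hz
        exact hB t (by simp [ht₁]) z (dist_le_two_of_adj_of_adj ht₂ hyz)
    have h₁ := Finset.card_le_card hsub
    rw [Finset.card_union_of_disjoint hd₂, Finset.card_union_of_disjoint hd₁,
      card_neighborFinset_eq_degree] at h₁
    have h₂ := one_add_le_card_twoStep hg h0 r
    have h₃ : G.degree r * (G.minDegree - 1) + G.degree r = G.degree r * G.minDegree := by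
      rw [← Nat.mul_succ, Nat.succ_eq_add_one, Nat.sub_add_cancel h0]
    omega
  · have hMprop : ∀ z ∈ M, z ≠ r ∧ ∃ x, G.Adj r x ∧ G.Adj x z := fun z hz => by
      rw [hM, Finset.mem_erase, mem_twoStep] at hz
      exact hz
    have hcard : ∀ z ∈ M, G.minDegree - 1 ≤ (G.neighborFinset z ∩ L).card := by
      intro z hz
      obtain ⟨hzr, x, hx₁, hx₂⟩ := hMprop z hz
      have hsub : (G.neighborFinset z).erase x ⊆ G.neighborFinset z ∩ L := by
        intro y hy
        simp only [Finset.mem_erase, mem_neighborFinset] at hy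
        simp only [hL, Finset.mem_inter, Finset.mem_sdiff, Finset.mem_biUnion, mem_neighborFinset]
        refine ⟨hy.2, ⟨z, hz, hy.2⟩, fun hry => hy.1 ?_⟩
        exact eq_of_common_neighbors_of_six_le_egirth hg hry hy.2.symm hx₂.symm hx₁.symm hzr.symm
      refine le_trans ?_ (Finset.card_le_card hsub)
      rw [Finset.card_erase_of_mem (by simpa using hx₂.symm), card_neighborFinset_eq_degree]
      exact Nat.sub_le_sub_right (G.minDegree_le_degree z) 1
    have hsub : M.biUnion (fun z => (G.neighborFinset z ∩ L).offDiag) ⊆ L.offDiag :=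
      Finset.biUnion_subset.2 fun z _ => Finset.offDiag_mono Finset.inter_subset_right
    have h₁ := Finset.card_le_card hsub
    rw [Finset.card_biUnion, Finset.offDiag_card, ← Nat.mul_sub_one] at h₁
    · refine le_trans ?_ h₁
      refine (Nat.mul_le_mul_right _ (degree_mul_le_card_twoStep_erase hg r)).trans ?_
      rw [← smul_eq_mul]
      refine Finset.card_nsmul_le_sum _ _ _ fun z hz => ?_
      rw [Finset.offDiag_card, ← Nat.mul_sub_one]
      exact Nat.mul_le_mul (hcard z hz) (Nat.sub_le_sub_right (hcard z hz) 1)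
    · intro z hz z' hz' hne
      rw [Function.onFun, Finset.disjoint_left]
      rintro ⟨x, y⟩ hxy hxy'
      simp only [Finset.mem_offDiag, Finset.mem_inter, mem_neighborFinset] at hxy hxy'
      exact hne (eq_of_common_neighbors_of_six_le_egirth hg hxy.1.1.symm hxy.2.1.1
        hxy'.2.1.1.symm hxy'.1.1 hxy.2.2)

end SimpleGraph

theorem eccent_le {V : Type*} {G : SimpleGraph V} [Nonempty V] {v : V} {m : ℕ}
    (h : ∀ x, G.dist v x ≤ m) : _root_.eccent G v ≤ m :=
  csSup_le (Set.range_nonempty _) (by rintro _ ⟨x, rfl⟩; exact h x)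

/-- Upper bound for the total eccentricity when every edge ball of radius two has at least `c`
vertices and the ball of radius three around some vertex has at least `C` vertices. -/
theorem sum_eccent_le {V : Type*} [Fintype V] {G : SimpleGraph V} (hG : G.Connected) {r s : V}
    (hrs : G.Adj r s) {c C : ℝ} (hc : 0 < c) (hC₀ : 0 ≤ C)
    (hedge : ∀ a b, G.Adj a b → ∀ B : Finset V, (∀ x, G.dist a x ≤ 2 → x ∈ B) →
      (∀ x, G.dist b x ≤ 2 → x ∈ B) → c ≤ B.card)
    (hC : ∀ B : Finset V, (∀ u ∈ insert r (G.neighborSet r), ∀ x, G.dist u x ≤ 2 → x ∈ B) →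
      C ≤ B.card) :
    ∑ v, (_root_.eccent G v : ℝ) ≤ (Fintype.card V - C) / (2 * c) * (9 * Fintype.card V + 3 * C) +
      21 * Fintype.card V := by
  classical
  obtain ⟨I, _, D, S, i₀, h, hdom⟩ := IsClustering.exists_dominating hG hrs
  have : Nonempty I := ⟨i₀⟩
  have : Nonempty V := ⟨r⟩
  have hf : ∀ v, ∃ i, (∃ u ∈ S i, G.dist u v ≤ 5) ∧ ∀ j, ∀ u ∈ S j, G.dist u v ≤ 2 → i = j := by
    intro v
    by_cases hv : ∃ j, ∃ u ∈ S j, G.dist u v ≤ 2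
    · obtain ⟨j, u, hu, huv⟩ := hv
      refine ⟨j, ⟨u, hu, by omega⟩, fun k u' hu' huv' => ?_⟩
      by_contra hne
      have h₁ := h.separated j k hne u hu u' hu'
      have h₂ := hG.dist_triangle (u := u) (v := v) (w := u')
      rw [G.dist_comm (u := v)] at h₂
      omega
    · obtain ⟨i, hi⟩ := hdom v
      exact ⟨i, hi, fun j u hu huv => absurd ⟨j, u, hu, huv⟩ hv⟩
  choose f hf₁ hf₂ using hf
  set B : I → Finset V := fun i => {v | f v = i} with hBdef
  have hmem : ∀ i, ∀ u ∈ S i, ∀ x, G.dist u x ≤ 2 → x ∈ B i := fun i u hu x hx => by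
    simpa [hBdef] using hf₂ x i u hu hx
  have hBc : ∀ i, c ≤ (B i).card := fun i => by
    obtain ⟨a, ha, b, hb, hab⟩ := h.exists_adj i
    exact hedge a b hab _ (hmem i a ha) (hmem i b hb)
  have hBC : C ≤ (B i₀).card := hC _ fun u hu => hmem i₀ u (h.root ▸ hu)
  have hsum : ∑ i, ((B i).card : ℝ) = Fintype.card V := by
    rw [← Nat.cast_sum, ← Finset.card_univ, Finset.card_eq_sum_card_fiberwise (f := f)
      (t := Finset.univ) (fun _ _ => Finset.mem_univ _)]
  have hecc : ∀ v, (_root_.eccent G v : ℝ) ≤ 6 * (Finset.univ.sup (D (f v)) : ℕ) + 12 := by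
    intro v
    suffices _root_.eccent G v ≤ 6 * Finset.univ.sup (D (f v)) + 12 by exact_mod_cast this
    refine eccent_le fun x => ?_
    obtain ⟨u, hu, huv⟩ := hf₁ v
    obtain ⟨u', hu', hux⟩ := hf₁ x
    have h₁ := h.dist_le _ _ u hu u' hu'
    have h₂ : D (f v) (f x) ≤ Finset.univ.sup (D (f v)) := Finset.le_sup (Finset.mem_univ _)
    have h₃ := hG.dist_triangle (u := v) (v := u) (w := x)
    have h₄ := hG.dist_triangle (u := u) (v := u') (w := x)
    rw [G.dist_comm (u := v) (v := u)] at h₃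
    omega
  have htotal : ∑ v, (_root_.eccent G v : ℝ) ≤
      6 * ∑ i, ((B i).card : ℝ) * (Finset.univ.sup (D i) : ℕ) + 12 * Fintype.card V := by
    refine (Finset.sum_le_sum fun v _ => hecc v).trans_eq ?_
    rw [Finset.sum_add_distrib, ← Finset.mul_sum,
      ← Finset.sum_fiberwise_of_maps_to (s := Finset.univ) (t := Finset.univ) (g := f)
        (fun _ _ => Finset.mem_univ _)]
    congr 2
    · refine Finset.sum_congr rfl fun i _ => ?_
      rw [← nsmul_eq_mul, ← Finset.sum_const]
      refine Finset.sum_congr rfl fun v hv => ?_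
      rw [(Finset.mem_filter.1 hv).2]
    · simp [mul_comm]
  obtain ⟨d, hd, hle⟩ := h.tree.sum_weight_mul_ecc_le (fun i => ((B i).card : ℝ)) c hc.le hBc
  rw [hsum] at hle
  set n : ℝ := (Fintype.card V : ℝ) with hn
  have hn₀ : 0 < n := by rw [hn]; exact_mod_cast Fintype.card_pos
  have hcn : c ≤ n := (hBc i₀).trans (by rw [hn]; exact_mod_cast Finset.card_le_univ _)
  have hcount : C + d * c ≤ n := by
    rw [← hsum, ← Finset.add_sum_erase _ _ (Finset.mem_univ i₀)]
    refine add_le_add hBC (le_trans ?_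
      (Finset.card_nsmul_le_sum _ _ c fun i _ => hBc i))
    rw [nsmul_eq_mul, Finset.card_erase_of_mem (Finset.mem_univ _), Finset.card_univ]
    have : d ≤ Fintype.card I - 1 := by omega
    gcongr
  set q := (n - C) / c with hq
  have hqc : q * c = n - C := by rw [hq]; field_simp
  have hdq : d ≤ q := by rw [hq, le_div_iff₀ hc]; linarith
  have hmono : 0 ≤ (q - d) * (n - c * (q + d) / 4) :=
    mul_nonneg (by linarith) (by nlinarith)
  have hrhs : (n - C) / (2 * c) * (9 * n + 3 * C) = q * (9 * n + 3 * C) / 2 := by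
    rw [hq]; field_simp
  have hCq : C = n - q * c := by linarith
  rw [hrhs, hCq]
  nlinarith

theorem stmt_10 {V : Type*} [Fintype V] (G : SimpleGraph V) [DecidableRel G.Adj]
    (hG : G.Connected) (hg : 6 ≤ G.egirth) (n δ Δ : ℕ)
    (hn : n = Fintype.card V) (hδ : δ = G.minDegree) (h3 : 3 ≤ δ)
    (hΔ : Δ ≤ G.maxDegree)
    (δs Δs : ℝ) (hδs : δs = 2 * ((δ : ℝ) ^ 2 - δ + 1))
    (hΔs : Δs = (Δ : ℝ) * δ + ((δ : ℝ) - 1) * Real.sqrt ((Δ : ℝ) * ((δ : ℝ) - 2)) + 3 / 2) :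
    avec G ≤ ((n : ℝ) - Δs) / (2 * δs) * ((9 * n + 3 * Δs) / n) + 21 := by
  classical
  have : Nonempty V := hG.nonempty
  obtain ⟨r, hr⟩ := G.exists_maximal_degree_vertex
  have h0 : 0 < G.minDegree := by omega
  have hδr : δ ≤ G.degree r := hδ ▸ G.minDegree_le_degree r
  obtain ⟨s, hs⟩ := (G.degree_pos_iff_exists_adj r).1 (by omega)
  have hδ₃ : (3 : ℝ) ≤ δ := by exact_mod_cast h3
  have hn₀ : (0 : ℝ) < n := by rw [hn]; exact_mod_cast Fintype.card_pos
  have hmain := sum_eccent_le hG hs (c := δs) (C := Δs) (by rw [hδs]; nlinarith)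
    (by
      have : 0 ≤ ((δ : ℝ) - 1) * Real.sqrt ((Δ : ℝ) * ((δ : ℝ) - 2)) :=
        mul_nonneg (by linarith) (Real.sqrt_nonneg _)
      rw [hΔs]; positivity)
    (fun a b hab B ha hb => by
      have := two_mul_le_card_of_adj hg h0 hab ha hb
      rw [← hδ] at this
      have hcast : ((2 * (1 + δ * (δ - 1)) : ℕ) : ℝ) = δs := by
        rw [hδs]; push_cast [Nat.cast_sub (show 1 ≤ δ by omega)]; ring
      rw [← hcast]
      exact_mod_cast this)
    (fun B hB => by
      obtain ⟨m, hm₁, hm₂⟩ := exists_le_card_of_ball_three hg h0 r hB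
      rw [← hδ] at hm₁ hm₂
      have hΔr : (Δ : ℝ) ≤ G.degree r := by exact_mod_cast hr ▸ hΔ
      have hm : 1 ≤ m := by
        by_contra hm
        have hpos : 0 < G.degree r * (δ - 1) * ((δ - 1) * (δ - 2)) :=
          Nat.mul_pos (Nat.mul_pos (by omega) (by omega)) (Nat.mul_pos (by omega) (by omega))
        have : m = 0 := by omega
        simp [this] at hm₂
        omega
      rify at hm₁ hm₂
      push_cast [Nat.cast_sub (show 1 ≤ δ by omega), Nat.cast_sub (show 2 ≤ δ by omega),
        Nat.cast_sub hm] at hm₁ hm₂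
      have hm' : (1 : ℝ) ≤ m := by exact_mod_cast hm
      have hsqrt : ((δ : ℝ) - 1) * Real.sqrt ((Δ : ℝ) * ((δ : ℝ) - 2)) ≤ m - 1 / 2 := by
        refine abs_le_of_sq_le_sq' ?_ (by linarith) |>.2
        rw [mul_pow, Real.sq_sqrt (mul_nonneg (by positivity) (by linarith))]
        have : (Δ : ℝ) * (((δ : ℝ) - 1) * ((δ - 1) * (δ - 2))) ≤
            G.degree r * (((δ : ℝ) - 1) * ((δ - 1) * (δ - 2))) :=
          mul_le_mul_of_nonneg_right hΔr (mul_nonneg (by linarith)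
            (mul_nonneg (by linarith) (by linarith)))
        nlinarith
      have : (Δ : ℝ) * δ ≤ G.degree r * δ := by gcongr
      rw [hΔs]
      linarith)
  rw [← hn] at hmain
  rw [avec, finsum_eq_sum_of_fintype, Nat.card_eq_fintype_card, ← hn, div_le_iff₀ hn₀]
  refine hmain.trans_eq ?_
  field_simp
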